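/- Let η = sup over i ∈ I and a, b ∈ [0,1]² of |g_{i,y}(a)| / |f_{i,x}(b)|, and let M ≥ 1 be the constant of the singular value comparability lemma (M⁻¹ ≤ α₁(D_a S_{i|n})/|f_{i|n,x}(a)| ≤ M and M⁻¹ ≤ α₂(D_a S_{i|n})/|g_{i|n,y}(a)| ≤ M for all a, i, n). Then η < 1, and for every i ∈ Σ and n ∈ ℕ, α₂(D_{Π(σⁿi)} S_{i|n}) / min_{b∈[0,1]²} α₁(D_b S_{i|n}) ≤ M² ηⁿ and α₂(D_{Π(σⁿi)} S_{i|n}) / max_{b∈[0,1]²} α₁(D_b S_{i|n}) ≤ M² ηⁿ. In particular both ratios tend to 0 as n → ∞, uniformly in i. -/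

import Mathlib

open MeasureTheory Filter Set

noncomputable section

namespace FFL

/-- The unit square `[0,1]² ⊆ ℝ²`. -/
def sq : Set (ℝ × ℝ) := Set.Icc (0:ℝ) 1 ×ˢ Set.Icc (0:ℝ) 1

/-- The Euclidean metric on `ℝ²`. -/
def dE (a b : ℝ × ℝ) : ℝ := Real.sqrt ((a.1 - b.1) ^ 2 + (a.2 - b.2) ^ 2)

/-- Squared Frobenius norm of a 2×2 real matrix. -/
def frobSq (A : Matrix (Fin 2) (Fin 2) ℝ) : ℝ := ∑ i, ∑ j, (A i j) ^ 2

/-- The larger singular value `α₁` of a 2×2 real matrix, i.e. the larger positive square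
root of the eigenvalues of `AᵀA`, via the standard closed formula. -/
def sv1 (A : Matrix (Fin 2) (Fin 2) ℝ) : ℝ :=
  Real.sqrt ((frobSq A + Real.sqrt ((frobSq A) ^ 2 - 4 * (A.det) ^ 2)) / 2)

/-- The smaller singular value `α₂` of a 2×2 real matrix. -/
def sv2 (A : Matrix (Fin 2) (Fin 2) ℝ) : ℝ :=
  Real.sqrt ((frobSq A - Real.sqrt ((frobSq A) ^ 2 - 4 * (A.det) ^ 2)) / 2)

/-- The nonlinear, non-conformal iterated function systems of Falconer, Fraser and Lee:
maps `S i (a₁,a₂) = (f i a₁, g i (a₁,a₂))` on the unit square, where `f i`, `g i` are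
`C^{1+α}` contractions (with partial derivatives `fx`, `gx`, `gy`) satisfying the
domination condition. -/
structure System (I : Type) [Fintype I] where
  f : I → ℝ → ℝ
  g : I → ℝ × ℝ → ℝ
  fx : I → ℝ → ℝ
  gx : I → ℝ × ℝ → ℝ
  gy : I → ℝ × ℝ → ℝ
  /-- the index set has at least two elements -/
  card2 : 2 ≤ Fintype.card I
  /-- each `S i` maps the unit square into itself -/
  mapsTo : ∀ i, Set.MapsTo (fun a => (f i a.1, g i a)) sq sq
  /-- `fx i` is the derivative of `f i` on `[0,1]` -/
  hasDeriv_f : ∀ i, ∀ x ∈ Set.Icc (0:ℝ) 1,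
    HasDerivWithinAt (f i) (fx i x) (Set.Icc (0:ℝ) 1) x
  /-- `(gx i, gy i)` is the (total) derivative of `g i` on the unit square -/
  hasDeriv_g : ∀ i, ∀ a ∈ sq, HasFDerivWithinAt (g i)
      (gx i a • ContinuousLinearMap.fst ℝ ℝ ℝ + gy i a • ContinuousLinearMap.snd ℝ ℝ ℝ) sq a
  /-- the derivatives are `α`-Hölder for some `α > 0`, i.e. `f i`, `g i` are `C^{1+α}` -/
  holder : ∃ α > (0:ℝ), ∃ H > (0:ℝ), ∀ i,
      (∀ x ∈ Set.Icc (0:ℝ) 1, ∀ y ∈ Set.Icc (0:ℝ) 1, |fx i x - fx i y| ≤ H * |x - y| ^ α) ∧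
      (∀ a ∈ sq, ∀ b ∈ sq, |gx i a - gx i b| ≤ H * dE a b ^ α) ∧
      (∀ a ∈ sq, ∀ b ∈ sq, |gy i a - gy i b| ≤ H * dE a b ^ α)
  /-- the maps `f i`, `g i` (hence `S i`) are uniform contractions -/
  contracting : ∃ c, 0 ≤ c ∧ c < 1 ∧ ∀ i,
      (∀ x ∈ Set.Icc (0:ℝ) 1, ∀ y ∈ Set.Icc (0:ℝ) 1, |f i x - f i y| ≤ c * |x - y|) ∧
      (∀ a ∈ sq, ∀ b ∈ sq, |g i a - g i b| ≤ c * dE a b) ∧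
      (∀ a ∈ sq, ∀ b ∈ sq, dE (f i a.1, g i a) (f i b.1, g i b) ≤ c * dE a b)
  /-- the domination condition:
  `inf |f_{i,x}| > sup |g_{i,y}| ≥ inf |g_{i,y}| ≥ d > 0` -/
  domination : ∃ d > (0:ℝ), ∀ i,
      d ≤ sInf ((fun a => |gy i a|) '' sq) ∧
      sSup ((fun a => |gy i a|) '' sq) < sInf ((fun x => |fx i x|) '' Set.Icc (0:ℝ) 1)

variable {I : Type} [Fintype I]

/-- The map `S i`. -/
def S (T : System I) (i : I) (a : ℝ × ℝ) : ℝ × ℝ := (T.f i a.1, T.g i a)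

/-- The composition `S_w = S_{i₁} ∘ ⋯ ∘ S_{i_n}` along a finite word `w = (i₁,…,i_n)`. -/
def Sw (T : System I) : List I → ℝ × ℝ → ℝ × ℝ
  | [], a => a
  | i :: w, a => S T i (Sw T w a)

/-- The top-left entry `f_{w,x}(a)` of the (lower triangular) Jacobian `D_a S_w`,
via the chain rule. -/
def fxw (T : System I) : List I → ℝ × ℝ → ℝ
  | [], _ => 1
  | i :: w, a => T.fx i (Sw T w a).1 * fxw T w a

/-- The bottom-right entry `g_{w,y}(a)` of the Jacobian `D_a S_w`. -/
def gyw (T : System I) : List I → ℝ × ℝ → ℝ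
  | [], _ => 1
  | i :: w, a => T.gy i (Sw T w a) * gyw T w a

/-- The off-diagonal entry `g_{w,x}(a)` of the Jacobian `D_a S_w`. -/
def gxw (T : System I) : List I → ℝ × ℝ → ℝ
  | [], _ => 0
  | i :: w, a => T.gx i (Sw T w a) * fxw T w a + T.gy i (Sw T w a) * gxw T w a

/-- The Jacobian matrix `D_a S_w`. -/
def Dmat (T : System I) (w : List I) (a : ℝ × ℝ) : Matrix (Fin 2) (Fin 2) ℝ :=
  !![fxw T w a, 0; gxw T w a, gyw T w a]

/-- The larger singular value `α₁(D_a S_w)`. -/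
def alpha1 (T : System I) (w : List I) (a : ℝ × ℝ) : ℝ := sv1 (Dmat T w a)

/-- The smaller singular value `α₂(D_a S_w)`. -/
def alpha2 (T : System I) (w : List I) (a : ℝ × ℝ) : ℝ := sv2 (Dmat T w a)

/-- The restriction `i|n` of an infinite sequence to its first `n` symbols. -/
def word (ii : ℕ → I) (n : ℕ) : List I := List.ofFn (fun k : Fin n => ii k.1)

/-- The iterated left shift `σⁿ`. -/
def shiftn (ii : ℕ → I) (n : ℕ) : ℕ → I := fun k => ii (k + n)

/-- The left shift `σ` on `Σ = I^ℕ`. -/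
def shift (ii : ℕ → I) : ℕ → I := fun k => ii (k + 1)

/-- The cylinder set `[w] ⊆ Σ` of a finite word `w`. -/
def cyl (w : List I) : Set (ℕ → I) := {jj | ∀ k : Fin w.length, jj k.1 = w.get k}

/-- `F` is the attractor of the IFS: the (unique) nonempty compact subset of the unit
square with `F = ⋃ i, S i '' F`. -/
def IsAttractor (T : System I) (F : Set (ℝ × ℝ)) : Prop :=
  F.Nonempty ∧ IsCompact F ∧ F ⊆ sq ∧ F = ⋃ i, S T i '' F

/-- The strong separation condition: the sets `S i '' F` are pairwise disjoint. -/
def SSC (T : System I) (F : Set (ℝ × ℝ)) : Prop :=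
  ∀ i j : I, i ≠ j → Disjoint (S T i '' F) (S T j '' F)

/-- `Pi` is the canonical coding map `Π : Σ → [0,1]²`:
`Π(i)` is the unique point of `⋂ₙ S_{i|n}([0,1]²)`. -/
def IsCoding (T : System I) (Pi : (ℕ → I) → ℝ × ℝ) : Prop :=
  ∀ ii : ℕ → I, ∀ n : ℕ, Pi ii ∈ Sw T (word ii n) '' sq

/-- `m` is quasi-Bernoulli with constant `L`:
`L⁻¹ m[w] m[v] ≤ m[wv] ≤ L m[w] m[v]` for all finite words `w, v`. -/
def QuasiBernoulli [MeasurableSpace I] (m : Measure (ℕ → I)) (L : ℝ) : Prop :=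
  0 < L ∧ ∀ w v : List I,
    L⁻¹ * (m (cyl w)).toReal * (m (cyl v)).toReal ≤ (m (cyl (w ++ v))).toReal ∧
    (m (cyl (w ++ v))).toReal ≤ L * (m (cyl w)).toReal * (m (cyl v)).toReal

/-- The interval `Q₁(x,r) = [x - r/2, x + r/2]`. -/
def Q1 (x r : ℝ) : Set ℝ := Set.Icc (x - r / 2) (x + r / 2)

/-- The square `Q₂(a,r) = (a₁ - r/2, a₁ + r/2) × (a₂ - r/2, a₂ + r/2)`. -/
def Q2 (a : ℝ × ℝ) (r : ℝ) : Set (ℝ × ℝ) :=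
  Set.Ioo (a.1 - r / 2) (a.1 + r / 2) ×ˢ Set.Ioo (a.2 - r / 2) (a.2 + r / 2)

/-- The approximate square `B_n(a,r)`: points `b ∈ S_w([0,1]²)` with `|b₁ - a₁| ≤ r/2`. -/
def Bn (T : System I) (w : List I) (a : ℝ × ℝ) (r : ℝ) : Set (ℝ × ℝ) :=
  {b ∈ Sw T w '' sq | |b.1 - a.1| ≤ r / 2}

/-- The closed Euclidean ball in `ℝ²`. -/
def ballE (x : ℝ × ℝ) (r : ℝ) : Set (ℝ × ℝ) := {y | dE x y ≤ r}

/-- A measure on `ℝ` is exact dimensional with dimension `s` if for a.e. `x`,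
`log ν(B(x,r)) / log r → s` as `r → 0⁺`. -/
def ExactDim1 (ν : Measure ℝ) (s : ℝ) : Prop :=
  ∀ᵐ x ∂ν, Tendsto (fun r => Real.log (ν (Metric.closedBall x r)).toReal / Real.log r)
    (nhdsWithin 0 (Set.Ioi 0)) (nhds s)

/-- A measure on `ℝ²` is exact dimensional with dimension `s` (w.r.t. Euclidean balls). -/
def ExactDim2 (ν : Measure (ℝ × ℝ)) (s : ℝ) : Prop :=
  ∀ᵐ x ∂ν, Tendsto (fun r => Real.log (ν (ballE x r)).toReal / Real.log r)
    (nhdsWithin 0 (Set.Ioi 0)) (nhds s)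

/-- `η = sup_{i ∈ I, a, b ∈ [0,1]²} |g_{i,y}(a)| / |f_{i,x}(b)|`. -/
def eta (T : System I) : ℝ :=
  sSup {x : ℝ | ∃ i : I, ∃ a ∈ sq, ∃ b ∈ sq, x = |T.gy i a| / |T.fx i b.1|}

end FFL

open FFL

namespace FFL

variable {I : Type} [Fintype I]

lemma Sw_mem_sq (T : System I) {a : ℝ × ℝ} (ha : a ∈ sq) : ∀ w : List I, Sw T w a ∈ sq
  | [] => ha
  | i :: w => T.mapsTo i (Sw_mem_sq T ha w)

lemma zero_mem_sq : ((0, 0) : ℝ × ℝ) ∈ sq := by simp [sq]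

lemma dE_le_two {a b : ℝ × ℝ} (ha : a ∈ sq) (hb : b ∈ sq) : dE a b ≤ 2 := by
  obtain ⟨⟨ha1, ha2⟩, ha3, ha4⟩ := ha
  obtain ⟨⟨hb1, hb2⟩, hb3, hb4⟩ := hb
  refine Real.sqrt_le_iff.mpr ⟨by norm_num, ?_⟩
  nlinarith

lemma bddAbove_abs_gy (T : System I) (i : I) : BddAbove ((fun a => |T.gy i a|) '' sq) := by
  obtain ⟨α, hα, H, hH, h⟩ := T.holder
  refine ⟨|T.gy i (0, 0)| + H * 2 ^ α, ?_⟩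
  rintro _ ⟨a, ha, rfl⟩
  have h1 := (h i).2.2 a ha _ zero_mem_sq
  have h2 : dE a (0, 0) ^ α ≤ 2 ^ α :=
    Real.rpow_le_rpow (Real.sqrt_nonneg _) (dE_le_two ha zero_mem_sq) hα.le
  have h3 := abs_sub_abs_le_abs_sub (T.gy i a) (T.gy i (0, 0))
  have h4 := mul_le_mul_of_nonneg_left h2 hH.le
  dsimp only
  linarith

/-- The domination condition in pointwise form, separated by constants `s < t`. -/
lemma exists_gy_le_lt_le_fx (T : System I) (i : I) : ∃ s t : ℝ, 0 ≤ s ∧ s < t ∧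
    (∀ a ∈ sq, |T.gy i a| ≤ s) ∧ ∀ b ∈ sq, t ≤ |T.fx i b.1| := by
  obtain ⟨d, -, h⟩ := T.domination
  refine ⟨_, _, ?_, (h i).2, fun a ha => le_csSup (bddAbove_abs_gy T i) ⟨a, ha, rfl⟩,
    fun b hb => csInf_le ⟨0, ?_⟩ ⟨b.1, hb.1, rfl⟩⟩
  · apply Real.sSup_nonneg
    rintro _ ⟨a, -, rfl⟩
    exact abs_nonneg _
  · rintro _ ⟨a, -, rfl⟩
    exact abs_nonneg _

lemma exists_ratio_le (T : System I) : ∃ c : ℝ, 0 ≤ c ∧ c < 1 ∧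
    ∀ i, ∀ a ∈ sq, ∀ b ∈ sq, |T.gy i a| / |T.fx i b.1| ≤ c := by
  have : Nonempty I := Fintype.card_pos_iff.mp (by have := T.card2; omega)
  choose s t hs hst hg hf using exists_gy_le_lt_le_fx T
  obtain ⟨j, hj⟩ := Finite.exists_max (fun i => s i / t i)
  have ht : ∀ i, 0 < t i := fun i => (hs i).trans_lt (hst i)
  refine ⟨s j / t j, div_nonneg (hs j) (ht j).le, (div_lt_one (ht j)).mpr (hst j),
    fun i a ha b hb => le_trans ?_ (hj i)⟩
  exact div_le_div₀ (hs i) (hg i a ha) (ht i) (hf i b hb)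

lemma eta_lt_one (T : System I) : eta T < 1 := by
  obtain ⟨c, hc0, hc1, hc⟩ := exists_ratio_le T
  refine (Real.sSup_le ?_ hc0).trans_lt hc1
  rintro _ ⟨i, a, ha, b, hb, rfl⟩
  exact hc i a ha b hb

lemma eta_nonneg (T : System I) : 0 ≤ eta T := by
  apply Real.sSup_nonneg
  rintro _ ⟨i, a, -, b, -, rfl⟩
  positivity

lemma abs_fx_pos (T : System I) (i : I) {b : ℝ × ℝ} (hb : b ∈ sq) : 0 < |T.fx i b.1| := by
  obtain ⟨s, t, hs, hst, -, hf⟩ := exists_gy_le_lt_le_fx T i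
  exact hs.trans_lt (hst.trans_le (hf b hb))

lemma abs_gy_pos (T : System I) (i : I) {a : ℝ × ℝ} (ha : a ∈ sq) : 0 < |T.gy i a| := by
  obtain ⟨d, hd, h⟩ := T.domination
  refine hd.trans_le ((h i).1.trans (csInf_le ⟨0, ?_⟩ ⟨a, ha, rfl⟩))
  rintro _ ⟨a, -, rfl⟩
  exact abs_nonneg _

lemma abs_gy_le_eta_mul (T : System I) (i : I) {a b : ℝ × ℝ} (ha : a ∈ sq) (hb : b ∈ sq) :
    |T.gy i a| ≤ eta T * |T.fx i b.1| := by
  obtain ⟨c, -, -, hc⟩ := exists_ratio_le T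
  rw [← div_le_iff₀ (abs_fx_pos T i hb)]
  refine le_csSup ⟨c, ?_⟩ ⟨i, a, ha, b, hb, rfl⟩
  rintro _ ⟨i, a, ha, b, hb, rfl⟩
  exact hc i a ha b hb

lemma abs_fxw_pos (T : System I) {b : ℝ × ℝ} (hb : b ∈ sq) : ∀ w : List I, 0 < |fxw T w b|
  | [] => by simp [fxw]
  | i :: w => by
    rw [fxw, abs_mul]
    exact mul_pos (abs_fx_pos T i (Sw_mem_sq T hb w)) (abs_fxw_pos T hb w)

lemma abs_gyw_pos (T : System I) {a : ℝ × ℝ} (ha : a ∈ sq) : ∀ w : List I, 0 < |gyw T w a|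
  | [] => by simp [gyw]
  | i :: w => by
    rw [gyw, abs_mul]
    exact mul_pos (abs_gy_pos T i (Sw_mem_sq T ha w)) (abs_gyw_pos T ha w)

lemma abs_gyw_le (T : System I) {a b : ℝ × ℝ} (ha : a ∈ sq) (hb : b ∈ sq) :
    ∀ w : List I, |gyw T w a| ≤ eta T ^ w.length * |fxw T w b|
  | [] => by simp [gyw, fxw]
  | i :: w => by
    rw [gyw, fxw, abs_mul, abs_mul, List.length_cons, pow_succ']
    calc _ ≤ (eta T * |T.fx i (Sw T w b).1|) * (eta T ^ w.length * |fxw T w b|) :=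
          mul_le_mul (abs_gy_le_eta_mul T i (Sw_mem_sq T ha w) (Sw_mem_sq T hb w))
            (abs_gyw_le T ha hb w) (abs_nonneg _)
            (mul_nonneg (eta_nonneg T) (abs_nonneg _))
      _ = _ := by ring

end FFL

/-- `η < 1` and the ratio of the singular values decays like `M² ηⁿ`,
uniformly in `i`. -/
theorem stmt14 {I : Type} [Fintype I] (T : System I)
    (Pi : (ℕ → I) → ℝ × ℝ) (hPi : IsCoding T Pi)
    (M : ℝ) (hM1 : 1 ≤ M)
    (hM : ∀ a ∈ sq, ∀ (jj : ℕ → I) (n : ℕ),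
      (M⁻¹ ≤ alpha1 T (word jj n) a / |fxw T (word jj n) a| ∧
        alpha1 T (word jj n) a / |fxw T (word jj n) a| ≤ M) ∧
      (M⁻¹ ≤ alpha2 T (word jj n) a / |gyw T (word jj n) a| ∧
        alpha2 T (word jj n) a / |gyw T (word jj n) a| ≤ M)) :
    eta T < 1 ∧
    ∀ (ii : ℕ → I) (n : ℕ),
      alpha2 T (word ii n) (Pi (shiftn ii n)) /
          sInf ((fun b => alpha1 T (word ii n) b) '' sq) ≤ M ^ 2 * eta T ^ n ∧
      alpha2 T (word ii n) (Pi (shiftn ii n)) /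
          sSup ((fun b => alpha1 T (word ii n) b) '' sq) ≤ M ^ 2 * eta T ^ n := by
  refine ⟨eta_lt_one T, fun ii n => ?_⟩
  have hP : Pi (shiftn ii n) ∈ sq := by
    obtain ⟨a, ha, h⟩ := hPi (shiftn ii n) 0
    exact h ▸ Sw_mem_sq T ha _
  have hM0 : 0 < M := by linarith
  have hC : 0 ≤ M ^ 2 * eta T ^ n := mul_nonneg (sq_nonneg M) (pow_nonneg (eta_nonneg T) n)
  set A := alpha2 T (word ii n) (Pi (shiftn ii n))
  have key : ∀ b ∈ sq, A ≤ M ^ 2 * eta T ^ n * alpha1 T (word ii n) b := by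
    intro b hb
    have h1 := (hM b hb ii n).1.1
    have h2 := (hM _ hP ii n).2.2
    rw [le_div_iff₀ (abs_fxw_pos T hb _), inv_mul_le_iff₀ hM0] at h1
    rw [div_le_iff₀ (abs_gyw_pos T hP _)] at h2
    have h3 := abs_gyw_le T hP hb (word ii n)
    rw [show (word ii n).length = n by simp [word]] at h3
    calc A ≤ M * (eta T ^ n * (M * alpha1 T (word ii n) b)) :=
          h2.trans (mul_le_mul_of_nonneg_left (h3.trans
            (mul_le_mul_of_nonneg_left h1 (pow_nonneg (eta_nonneg T) n))) hM0.le)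
      _ = _ := by ring
  set s := (fun b => alpha1 T (word ii n) b) '' sq
  have hs0 : ∀ x ∈ s, 0 ≤ x := by
    rintro _ ⟨b, -, rfl⟩
    exact Real.sqrt_nonneg _
  have hne : s.Nonempty := ⟨_, _, zero_mem_sq, rfl⟩
  constructor
  · refine div_le_of_le_mul₀ (Real.sInf_nonneg hs0) hC ?_
    rw [← smul_eq_mul (M ^ 2 * eta T ^ n), ← Real.sInf_smul_of_nonneg hC]
    refine le_csInf hne.smul_set ?_
    rintro _ ⟨_, ⟨b, hb, rfl⟩, rfl⟩
    exact key b hb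
  · by_cases hbd : BddAbove s
    · refine div_le_of_le_mul₀ (Real.sSup_nonneg hs0) hC ((key _ zero_mem_sq).trans ?_)
      exact mul_le_mul_of_nonneg_left (le_csSup hbd ⟨_, zero_mem_sq, rfl⟩) hC
    · rw [Real.sSup_of_not_bddAbove hbd, div_zero]
      exact hC
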